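/- Let d be a derivation of the octonion model O which is skew with respect to the polar form b (i.e. b(d(x),y) + b(x,d(y)) = 0 for all x,y ∈ O) and whose range is 2-dimensional. Then the range of d is a null plane (u·v = 0 for all u,v in the range), and the kernel of d equals the b-orthogonal complement of the range; the kernel is a 6-dimensional subalgebra of O containing the unit (I,0,0). -/

import Mathlib

open Matrix

noncomputable section

/-- 2×2 complex matrices. -/
abbrev M2 : Type := Matrix (Fin 2) (Fin 2) ℂ
/-- ℂ². -/
abbrev V2 : Type := Fin 2 → ℂ
/-- The dual space (ℂ²)*. -/
abbrev Dual2 : Type := Module.Dual ℂ V2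

/-- `X⁰ = (tr X)·I − X`. -/
def msharp (X : M2) : M2 := X.trace • (1 : M2) - X

/-- The rank-one matrix u ⊗ v* : w ↦ v*(w)·u. -/
def rankOne (u : V2) (vs : Dual2) : M2 := vecMulVec u fun j => vs (Pi.single j 1)

/-- The underlying vector space of the octonion model: M₂(ℂ) × ℂ² × (ℂ²)*. -/
abbrev Ox : Type := M2 × V2 × Dual2

/-- Octonion multiplication:
(X,u,u*)·(Y,v,v*) = (XY − 2·u⊗v* − 2·(v⊗u*)⁰, X⁰v + Yu, v*∘X + u*∘Y⁰). -/
def mulO (p q : Ox) : Ox :=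
  (p.1 * q.1 - (2 : ℂ) • rankOne p.2.1 q.2.2 - (2 : ℂ) • msharp (rankOne q.2.1 p.2.2),
   msharp p.1 *ᵥ q.2.1 + q.1 *ᵥ p.2.1,
   q.2.2 ∘ₗ Matrix.mulVecLin p.1 + p.2.2 ∘ₗ Matrix.mulVecLin (msharp q.1))

/-- The octonion norm q(X,u,u*) = det X + 2·u*(u). -/
def qO (p : Ox) : ℂ := p.1.det + 2 * p.2.2 p.2.1

/-- The polar form of the octonion norm. -/
def bO (p q : Ox) : ℂ := qO (p + q) - qO p - qO q

/-- The unit (I,0,0) of the octonion model. -/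
def oneO : Ox := (1, 0, 0)

namespace Ox

lemma dual_apply (f : Dual2) (w : V2) :
    f w = w 0 * f (Pi.single 0 1) + w 1 * f (Pi.single 1 1) := by
  conv_lhs => rw [pi_eq_sum_univ' w]
  simp [Fin.sum_univ_two]

lemma ext_coord {p r : Ox} (h : ∀ i j, p.1 i j = r.1 i j) (h' : ∀ i, p.2.1 i = r.2.1 i)
    (h'' : ∀ i : Fin 2, p.2.2 (Pi.single i 1) = r.2.2 (Pi.single i 1)) : p = r := by
  refine Prod.ext (Matrix.ext h) (Prod.ext (funext h') (LinearMap.ext fun w => ?_))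
  rw [dual_apply, dual_apply r.2.2, h'' 0, h'' 1]

lemma qO_eq (p : Ox) : qO p = p.1 0 0 * p.1 1 1 - p.1 0 1 * p.1 1 0 +
    2 * (p.2.1 0 * p.2.2 (Pi.single 0 1) + p.2.1 1 * p.2.2 (Pi.single 1 1)) := by
  rw [qO, dual_apply, Matrix.det_fin_two]

lemma mulO_fst (p r : Ox) (i j : Fin 2) : (mulO p r).1 i j =
    p.1 i 0 * r.1 0 j + p.1 i 1 * r.1 1 j - 2 * (p.2.1 i * r.2.2 (Pi.single j 1)) -
    2 * ((r.2.1 0 * p.2.2 (Pi.single 0 1) + r.2.1 1 * p.2.2 (Pi.single 1 1)) * (1 : M2) i j -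
      r.2.1 i * p.2.2 (Pi.single j 1)) := by
  simp [mulO, msharp, rankOne, Matrix.mul_apply, Fin.sum_univ_two, Matrix.trace, vecMulVec_apply]

lemma mulO_snd (p r : Ox) (i : Fin 2) : (mulO p r).2.1 i =
    (p.1 0 0 + p.1 1 1) * r.2.1 i - (p.1 i 0 * r.2.1 0 + p.1 i 1 * r.2.1 1) +
    (r.1 i 0 * p.2.1 0 + r.1 i 1 * p.2.1 1) := by
  simp only [mulO, msharp, Matrix.sub_mulVec, Matrix.smul_mulVec, Matrix.one_mulVec, Pi.add_apply,
    Pi.sub_apply, Pi.smul_apply, smul_eq_mul, Matrix.trace_fin_two]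
  simp only [Matrix.mulVec, dotProduct, Fin.sum_univ_two]

lemma mulO_trd (p r : Ox) (i : Fin 2) : (mulO p r).2.2 (Pi.single i 1) =
    p.1 0 i * r.2.2 (Pi.single 0 1) + p.1 1 i * r.2.2 (Pi.single 1 1) +
    ((r.1 0 0 + r.1 1 1) * p.2.2 (Pi.single i 1) -
      (r.1 0 i * p.2.2 (Pi.single 0 1) + r.1 1 i * p.2.2 (Pi.single 1 1))) := by
  have hmul (A : M2) (k : Fin 2) : (A *ᵥ Pi.single i 1) k = A k i := by simp
  simp only [mulO, LinearMap.add_apply, LinearMap.comp_apply]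
  rw [Matrix.mulVecLin_apply, Matrix.mulVecLin_apply, dual_apply, dual_apply p.2.2 (_ *ᵥ _)]
  simp only [hmul, msharp, Matrix.sub_apply, Matrix.smul_apply, smul_eq_mul, Matrix.trace_fin_two]
  obtain rfl | rfl : i = 0 ∨ i = 1 := by omega
  all_goals simp; ring

lemma bO_eq (p r : Ox) : bO p r =
    p.1 0 0 * r.1 1 1 + p.1 1 1 * r.1 0 0 - p.1 0 1 * r.1 1 0 - p.1 1 0 * r.1 0 1 +
    2 * (p.2.1 0 * r.2.2 (Pi.single 0 1) + p.2.1 1 * r.2.2 (Pi.single 1 1) +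
      r.2.1 0 * p.2.2 (Pi.single 0 1) + r.2.1 1 * p.2.2 (Pi.single 1 1)) := by
  simp only [bO, qO_eq, Prod.fst_add, Prod.snd_add, Matrix.add_apply, Pi.add_apply,
    LinearMap.add_apply]
  ring

lemma mulO_add_left (p p' r : Ox) : mulO (p + p') r = mulO p r + mulO p' r := by
  apply ext_coord <;> intros <;>
    simp only [mulO_fst, mulO_snd, mulO_trd, Prod.fst_add, Prod.snd_add, Matrix.add_apply,
      Pi.add_apply, LinearMap.add_apply] <;> ring

lemma mulO_add_right (p r r' : Ox) : mulO p (r + r') = mulO p r + mulO p r' := by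
  apply ext_coord <;> intros <;>
    simp only [mulO_fst, mulO_snd, mulO_trd, Prod.fst_add, Prod.snd_add, Matrix.add_apply,
      Pi.add_apply, LinearMap.add_apply] <;> ring

lemma mulO_smul_left (c : ℂ) (p r : Ox) : mulO (c • p) r = c • mulO p r := by
  apply ext_coord <;> intros <;>
    simp only [mulO_fst, mulO_snd, mulO_trd, Prod.smul_fst, Prod.smul_snd, Matrix.smul_apply,
      Pi.smul_apply, LinearMap.smul_apply, smul_eq_mul] <;> ring

lemma mulO_smul_right (c : ℂ) (p r : Ox) : mulO p (c • r) = c • mulO p r := by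
  apply ext_coord <;> intros <;>
    simp only [mulO_fst, mulO_snd, mulO_trd, Prod.smul_fst, Prod.smul_snd, Matrix.smul_apply,
      Pi.smul_apply, LinearMap.smul_apply, smul_eq_mul] <;> ring

/-- The octonion product as a bilinear map. -/
def mulLin : Ox →ₗ[ℂ] Ox →ₗ[ℂ] Ox :=
  LinearMap.mk₂ ℂ mulO mulO_add_left mulO_smul_left mulO_add_right mulO_smul_right

@[simp] lemma mulLin_apply (p r : Ox) : mulLin p r = mulO p r := rfl

lemma mulO_zero (p : Ox) : mulO p 0 = 0 := (mulLin p).map_zero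

lemma zero_mulO (p : Ox) : mulO 0 p = 0 := LinearMap.map_zero₂ mulLin p

lemma mulO_oneO (p : Ox) : mulO p oneO = p := by
  simp only [mulO, oneO, msharp, rankOne]
  refine ext_coord (fun i j => ?_) (fun i => ?_) fun i => ?_ <;>
    simp [vecMulVec_apply, Matrix.trace]
  ring

lemma oneO_mulO (p : Ox) : mulO oneO p = p := by
  refine ext_coord (fun i j => ?_) (fun i => ?_) fun i => ?_ <;>
    fin_cases i <;> try fin_cases j
  all_goals simp [oneO, mulO_fst, mulO_snd, mulO_trd, one_add_one_eq_two, two_mul]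

lemma zero_bO (p : Ox) : bO 0 p = 0 := by
  simp [bO_eq]

lemma eq_zero_of_bO_eq_zero {p : Ox} (h : ∀ r, bO p r = 0) : p = 0 := by
  have hM (M : M2) := h (M, 0, 0)
  have hv (v : V2) := h (0, v, 0)
  have hf (f : Dual2) := h (0, 0, f)
  refine ext_coord (fun i j => ?_) (fun i => ?_) fun i => ?_
  · have := hM (Matrix.single 0 0 1)
    have := hM (Matrix.single 0 1 1)
    have := hM (Matrix.single 1 0 1)
    have := hM (Matrix.single 1 1 1)
    fin_cases i <;> fin_cases j <;> simp_all [bO_eq]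
  · have := hf (LinearMap.proj i)
    fin_cases i <;> simpa [bO_eq] using this
  · have := hv (Pi.single i 1)
    fin_cases i <;> simpa [bO_eq] using this

lemma finrank_eq : Module.finrank ℂ Ox = 8 := by
  simp [Module.finrank_prod, Module.finrank_matrix]

lemma fst_eq_zero_of_mulO_eq_zero {p u : Ox} (hu : qO u ≠ 0) (hp : p.2 = 0)
    (h : mulO p u = 0) : p.1 = 0 := by
  have h1 (i j) := congrArg (fun x : Ox => x.1 i j) h
  have h2 (i) := congrArg (fun x : Ox => x.2.1 i) h
  have h3 (i : Fin 2) := congrArg (fun x : Ox => x.2.2 (Pi.single i 1)) h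
  simp only [mulO_fst, mulO_snd, mulO_trd, hp, Prod.fst_zero, Prod.snd_zero, Pi.zero_apply,
    LinearMap.zero_apply, Matrix.zero_apply] at h1 h2 h3
  rw [qO_eq] at hu
  ext i j
  refine (mul_eq_zero.1 ?_).resolve_left hu
  fin_cases i <;> fin_cases j <;> simp only [Fin.zero_eta, Fin.mk_one]
  · linear_combination h1 0 0 * u.1 1 1 - h1 0 1 * u.1 1 0 + 2 * u.2.1 0 * h3 0
      + 2 * h2 1 * u.2.2 (Pi.single 1 1)
  · linear_combination -h1 0 0 * u.1 0 1 + h1 0 1 * u.1 0 0 + 2 * u.2.1 0 * h3 1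
      - 2 * h2 0 * u.2.2 (Pi.single 1 1)
  · linear_combination h1 1 0 * u.1 1 1 - h1 1 1 * u.1 1 0 + 2 * u.2.1 1 * h3 0
      - 2 * h2 1 * u.2.2 (Pi.single 0 1)
  · linear_combination -h1 1 0 * u.1 0 1 + h1 1 1 * u.1 0 0 + 2 * u.2.1 1 * h3 1
      + 2 * h2 0 * u.2.2 (Pi.single 0 1)

lemma apply_add_apply_eq_zero_of_mulO_eq_zero {p u : Ox} (hu : qO u ≠ 0) (h : mulO p u = 0) :
    u.2.2 p.2.1 + p.2.2 u.2.1 = 0 := by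
  have h1 (i j) := congrArg (fun x : Ox => x.1 i j) h
  have h2 (i) := congrArg (fun x : Ox => x.2.1 i) h
  have h3 (i : Fin 2) := congrArg (fun x : Ox => x.2.2 (Pi.single i 1)) h
  simp only [mulO_fst, mulO_snd, mulO_trd, Prod.fst_zero, Prod.snd_zero, Pi.zero_apply,
    LinearMap.zero_apply, Matrix.zero_apply] at h1 h2 h3
  rw [qO_eq] at hu
  refine (mul_eq_zero.1 ?_).resolve_left hu
  rw [dual_apply u.2.2 p.2.1, dual_apply p.2.2 u.2.1]
  have h00 := h1 0 0
  have h11 := h1 1 1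
  simp only [Matrix.one_apply_eq] at h00 h11
  linear_combination
    u.2.2 (Pi.single 0 1) * (u.1 1 1 * h2 0 - u.1 0 1 * h2 1) +
    u.2.2 (Pi.single 1 1) * (u.1 0 0 * h2 1 - u.1 1 0 * h2 0) +
    h3 0 * (u.1 0 0 * u.2.1 0 + u.1 0 1 * u.2.1 1) +
    h3 1 * (u.1 1 0 * u.2.1 0 + u.1 1 1 * u.2.1 1) -
    (u.2.1 0 * u.2.2 (Pi.single 0 1) + u.2.1 1 * u.2.2 (Pi.single 1 1)) * (h00 + h11)

/-- Right multiplication by an anisotropic element kills no subspace of dimension at least four. -/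
lemma finrank_lt_four_of_mulO_eq_zero {u : Ox} (hu : qO u ≠ 0) {N : Submodule ℂ Ox}
    (hN : ∀ p ∈ N, mulO p u = 0) : Module.finrank ℂ N < 4 := by
  by_contra! h4
  let π : N →ₗ[ℂ] V2 × Dual2 := LinearMap.snd ℂ M2 (V2 × Dual2) ∘ₗ N.subtype
  have hinj : Function.Injective π := by
    rw [← LinearMap.ker_eq_bot, LinearMap.ker_eq_bot']
    rintro ⟨p, hp⟩ (h : p.2 = 0)
    exact Subtype.ext (Prod.ext (fst_eq_zero_of_mulO_eq_zero hu h (hN p hp)) h)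
  have hW : Module.finrank ℂ (V2 × Dual2) = 4 := by simp [Module.finrank_prod]
  have hle := LinearMap.finrank_le_finrank_of_injective hinj
  have hsurj : Function.Surjective π :=
    (LinearMap.injective_iff_surjective_of_finrank_eq_finrank (by omega)).1 hinj
  have key (w : V2 × Dual2) : ∃ X : M2, mulO (X, w) u = 0 := by
    obtain ⟨⟨⟨X, w'⟩, hp⟩, rfl⟩ := hsurj w
    exact ⟨X, hN _ hp⟩
  have hf : u.2.2 = 0 := by
    refine LinearMap.ext fun v => ?_
    obtain ⟨X, hX⟩ := key (v, 0)
    simpa using apply_add_apply_eq_zero_of_mulO_eq_zero hu hX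
  have ha : u.2.1 = 0 := by
    refine funext fun i => ?_
    obtain ⟨X, hX⟩ := key (0, LinearMap.proj i)
    simpa using apply_add_apply_eq_zero_of_mulO_eq_zero hu hX
  have hdet : u.1.det ≠ 0 := by simpa [qO, hf] using hu
  obtain ⟨X, hX⟩ := key (fun _ => 1, 0)
  have h := congrArg (fun x : Ox => x.2.1) hX
  simp only [mulO, ha, Matrix.mulVec_zero, zero_add] at h
  exact one_ne_zero (congrFun (Matrix.eq_zero_of_mulVec_eq_zero hdet h) 0)

end Ox

/-- if d is a b-skew derivation of O with 2-dimensional range, then the range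
is a null plane, the kernel is the b-orthogonal complement of the range, and the kernel is a
6-dimensional subalgebra of O containing the unit. -/
theorem skew_rank_two_derivation_range_null_plane_kernel_sextonions
    (d : Ox →ₗ[ℂ] Ox)
    (hder : ∀ x y : Ox, d (mulO x y) = mulO (d x) y + mulO x (d y))
    (hskew : ∀ x y : Ox, bO (d x) y + bO x (d y) = 0)
    (hrank : Module.finrank ℂ (LinearMap.range d) = 2) :
    -- the range is a null plane
    (∀ x ∈ LinearMap.range d, ∀ y ∈ LinearMap.range d, mulO x y = 0) ∧
    -- the kernel is the b-orthogonal complement of the range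
    (∀ x : Ox, x ∈ LinearMap.ker d ↔ ∀ y ∈ LinearMap.range d, bO x y = 0) ∧
    -- the kernel is a 6-dimensional subalgebra containing the unit
    Module.finrank ℂ (LinearMap.ker d) = 6 ∧
    (∀ x ∈ LinearMap.ker d, ∀ y ∈ LinearMap.ker d, mulO x y ∈ LinearMap.ker d) ∧
    oneO ∈ LinearMap.ker d := by
  have hmem {x : Ox} : x ∈ LinearMap.ker d ↔ ∀ y ∈ LinearMap.range d, bO x y = 0 := by
    rw [LinearMap.mem_ker]
    constructor
    · rintro hx _ ⟨y, rfl⟩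
      simpa only [hx, Ox.zero_bO, zero_add] using hskew x y
    · intro h
      refine Ox.eq_zero_of_bO_eq_zero fun y => ?_
      simpa only [h _ ⟨y, rfl⟩, add_zero] using hskew x y
  have hker : Module.finrank ℂ (LinearMap.ker d) = 6 := by
    have := LinearMap.finrank_range_add_finrank_ker d
    rw [hrank, Ox.finrank_eq] at this
    omega
  have hone : oneO ∈ LinearMap.ker d := by
    have h := hder oneO oneO
    rwa [Ox.mulO_oneO, Ox.mulO_oneO, Ox.oneO_mulO, left_eq_add] at h
  have hact : ∀ x ∈ LinearMap.ker d, ∀ y ∈ LinearMap.range d, mulO x y ∈ LinearMap.range d := by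
    rintro x hx _ ⟨y, rfl⟩
    exact ⟨mulO x y, by rw [hder, LinearMap.mem_ker.1 hx, Ox.zero_mulO, zero_add]⟩
  have hq : ∀ x ∈ LinearMap.range d, qO x = 0 := by
    intro u hu
    by_contra hqu
    let ρ : LinearMap.ker d →ₗ[ℂ] Ox := Ox.mulLin.flip u ∘ₗ (LinearMap.ker d).subtype
    have hle : LinearMap.range ρ ≤ LinearMap.range d := by
      rintro _ ⟨x, rfl⟩
      exact hact x x.2 u hu
    have h1 := Submodule.finrank_mono hle
    have h2 := LinearMap.finrank_range_add_finrank_ker ρ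
    have h3 := Ox.finrank_lt_four_of_mulO_eq_zero hqu
      (N := (LinearMap.ker ρ).map (LinearMap.ker d).subtype) <| by
        rintro _ ⟨x, hx, rfl⟩
        exact hx
    rw [Submodule.finrank_map_subtype_eq] at h3
    omega
  have hsub : LinearMap.range d ≤ LinearMap.ker d := fun x hx => hmem.2 fun y hy => by
    have h := hq _ (add_mem hx hy)
    rw [bO, h, hq x hx, hq y hy, sub_zero, sub_zero]
  refine ⟨?_, fun x => hmem, hker, fun x hx y hy => ?_, hone⟩
  · rintro _ ⟨x, rfl⟩ _ ⟨y, rfl⟩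
    have hsq (z : Ox) : d (d z) = 0 := hsub ⟨z, rfl⟩
    have h := hsq (mulO x y)
    rw [hder, map_add, hder, hder, hsq, hsq, Ox.zero_mulO, Ox.mulO_zero, zero_add, add_zero] at h
    rw [← two_smul ℂ] at h
    exact (smul_eq_zero.1 h).resolve_left two_ne_zero
  · rw [LinearMap.mem_ker] at hx hy ⊢
    rw [hder, hx, hy, Ox.zero_mulO, Ox.mulO_zero, add_zero]

end
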